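/- arXiv:2007.09821 — 2 statements merged into one kernel-verified Lean document; each statement's English description precedes it below -/
import Mathlib

section
/- Fix integers q ≥ 1 and 0 ≤ r < s, and let b_k = B_k((x+r)/q) − B_k((x+s)/q). Then for all integers m ≥ 0, the Hankel determinant H_{2m}(b_k) = det_{0≤i,j≤2m}(b_{i+j}) equals 0, and H_{2m+1}(b_k) = (−1)^{m+1} ((s−r)/q^{m+1})^{2m+2} · Π_{ℓ=1}^{m} ( ℓ^4((s−r)^2 − (qℓ)^2) / (4(2ℓ+1)(2ℓ−1)) )^{2(m+1−ℓ)}. -/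
/-- The `n`-th Hankel determinant of a sequence `c`. -/
noncomputable def hankel {R : Type*} [CommRing R] (c : ℕ → R) (n : ℕ) : R :=
  (Matrix.of fun i j : Fin (n + 1) => c (i.1 + j.1)).det

open Polynomial in
/-- The `ℚ`-linear endomorphism of `ℚ[X]` sending `X ^ n` to the `n`-th Bernoulli polynomial. -/
noncomputable def bernoulliMap : ℚ[X] →ₗ[ℚ] ℚ[X] :=
  (Polynomial.basisMonomials ℚ).constr ℚ Polynomial.bernoulli

namespace bernoulliMap

open Polynomial

lemma map_X_pow (n : ℕ) : bernoulliMap (X ^ n) = Polynomial.bernoulli n := by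
  have h := (Polynomial.basisMonomials ℚ).constr_basis ℚ Polynomial.bernoulli n
  simpa only [bernoulliMap, Polynomial.coe_basisMonomials, Polynomial.monomial_one_right_eq_X_pow] using h

lemma hasseDeriv_bernoulli (n k : ℕ) :
    hasseDeriv k (Polynomial.bernoulli n) = (n.choose k : ℚ) • Polynomial.bernoulli (n - k) := by
  ext m
  rw [hasseDeriv_coeff, coeff_smul, coeff_bernoulli, coeff_bernoulli, smul_eq_mul]
  by_cases h : m + k ≤ n
  · have hm : m ≤ n - k := by omega
    have hc : (m + k).choose k * n.choose (m + k) = n.choose k * (n - k).choose m := by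
      have := Nat.choose_mul (n := n) (k := m + k) (s := k) (by omega)
      rw [Nat.add_sub_cancel] at this
      rw [mul_comm, this]
    have hc' : (((m + k).choose k : ℕ) : ℚ) * (n.choose (m + k) : ℕ)
        = (n.choose k : ℕ) * ((n - k).choose m : ℕ) := by exact_mod_cast hc
    rw [if_pos h, if_pos hm, show n - k - m = n - (m + k) by omega]
    linear_combination _root_.bernoulli (n - (m + k)) * hc'
  · rw [if_neg h]
    rcases le_or_gt k n with hk | hk
    · rw [if_neg (by omega)]; simp
    · rw [Nat.choose_eq_zero_of_lt hk]; simp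

lemma taylor_bernoulli (h : ℚ) (n : ℕ) :
    taylor h (Polynomial.bernoulli n) =
      ∑ k ∈ Finset.range (n + 1), (h ^ (n - k) * n.choose k) • Polynomial.bernoulli k := by
  refine Polynomial.funext fun z => ?_
  have hdeg : (taylor z (Polynomial.bernoulli n)).natDegree < n + 1 := by
    rw [natDegree_taylor, Nat.lt_succ_iff, natDegree_le_iff_coeff_eq_zero]
    intro i hi
    rw [coeff_bernoulli, if_neg (by omega)]
  rw [taylor_eval, add_comm z h, ← taylor_eval, eval_eq_sum_range' hdeg, eval_finsetSum,
    ← Finset.sum_range_reflect]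
  refine Finset.sum_congr rfl fun k hk => ?_
  have hk' : k ≤ n := by simpa [Nat.lt_succ_iff] using hk
  rw [taylor_coeff, hasseDeriv_bernoulli, show n + 1 - 1 - k = n - k by omega,
    Nat.sub_sub_self hk', Nat.choose_symm hk', eval_smul, eval_smul, smul_eq_mul, smul_eq_mul]
  ring

lemma map_taylor (h : ℚ) (p : ℚ[X]) :
    bernoulliMap (taylor h p) = taylor h (bernoulliMap p) := by
  have key : bernoulliMap ∘ₗ taylor h = taylor h ∘ₗ bernoulliMap := by
    refine Polynomial.lhom_ext' fun n => LinearMap.ext_ring ?_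
    simp only [LinearMap.comp_apply, monomial_one_right_eq_X_pow, map_X_pow, taylor_X_pow,
      taylor_bernoulli, add_pow, map_sum]
    refine Finset.sum_congr rfl fun k _ => ?_
    rw [← map_X_pow k, ← map_smul]
    congr 1
    rw [smul_eq_C_mul, map_mul, map_pow, map_natCast]
    ring
  exact LinearMap.congr_fun key p

lemma taylor_one_map (p : ℚ[X]) :
    taylor 1 (bernoulliMap p) = bernoulliMap p + derivative p := by
  have key : taylor 1 ∘ₗ bernoulliMap = bernoulliMap + derivative := by
    refine Polynomial.lhom_ext' fun n => LinearMap.ext_ring ?_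
    simp only [LinearMap.comp_apply, LinearMap.add_apply, monomial_one_right_eq_X_pow, map_X_pow,
      taylor_apply, derivative_X_pow]
    rw [add_comm X, C_1, bernoulli_comp_one_add_X]
    simp
  exact LinearMap.congr_fun key p

/-- The Bernoulli map turns central differences into shifted derivatives. -/
lemma eval_map_central_diff (p : ℚ[X]) (z : ℚ) :
    (bernoulliMap (taylor (1 / 2) p - taylor (-1 / 2) p)).eval z
      = (derivative p).eval (z - 1 / 2) := by
  have h := congrArg (eval (z - 1 / 2)) (taylor_one_map p)
  rw [taylor_eval, eval_add] at h
  rw [map_sub, map_taylor, map_taylor, eval_sub, taylor_eval, taylor_eval]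
  rw [show z - 1 / 2 + 1 = z + 1 / 2 by ring] at h
  rw [show z + -1 / 2 = z - 1 / 2 by ring, h]
  ring

end bernoulliMap

section ChangeOfBasis

open Polynomial

lemma hankel_eq_det_of_monic {R : Type*} [CommRing R] (M : R[X] →ₗ[R] R) (p r : ℕ → R[X])
    (hp : ∀ i, (p i).natDegree = i) (hpm : ∀ i, (p i).Monic)
    (hr : ∀ i, (r i).natDegree = i) (hrm : ∀ i, (r i).Monic) (n : ℕ) :
    hankel (fun k => M (X ^ k)) n
      = (Matrix.of fun i j : Fin (n + 1) => M (p i * r j)).det := by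
  have hfac : (Matrix.of fun i j : Fin (n + 1) => M (p i * r j))
      = (Matrix.of fun i j : Fin (n + 1) => (p j).coeff i).transpose
        * (Matrix.of fun i j : Fin (n + 1) => M (X ^ (i.1 + j.1)))
        * (Matrix.of fun i j : Fin (n + 1) => (r j).coeff i) := by
    ext i j
    have expand_sum : ∀ f : R[X], f.natDegree < n + 1 →
        f = ∑ k : Fin (n + 1), f.coeff k • X ^ (k : ℕ) := by
      intro f hf
      rw [Fin.sum_univ_eq_sum_range (fun k => f.coeff k • (X : R[X]) ^ k) (n + 1)]
      simp_rw [smul_eq_C_mul]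
      exact f.as_sum_range_C_mul_X_pow' hf
    simp only [Matrix.mul_apply, Matrix.of_apply, Matrix.transpose_apply]
    conv_lhs =>
      rw [expand_sum (p i) (by rw [hp]; exact i.2), expand_sum (r j) (by rw [hr]; exact j.2),
        Finset.mul_sum, map_sum]
    refine Finset.sum_congr rfl fun k _ => ?_
    rw [Finset.sum_mul, map_sum, Finset.sum_mul]
    refine Finset.sum_congr rfl fun l _ => ?_
    rw [smul_mul_smul_comm, map_smul, ← pow_add, smul_eq_mul]
    ring
  have hpd := Matrix.det_matrixOfPolynomials (fun i : Fin (n + 1) => p i)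
    (fun i => hp i) (fun i => hpm i)
  have hrd := Matrix.det_matrixOfPolynomials (fun i : Fin (n + 1) => r i)
    (fun i => hr i) (fun i => hrm i)
  rw [hfac, Matrix.det_mul, Matrix.det_mul, Matrix.det_transpose, hpd, hrd, hankel]
  ring

end ChangeOfBasis

section Checkerboard

/-- Hankel determinants of odd size vanish when the even-indexed terms do. -/
lemma hankel_even_eq_zero (c : ℕ → ℚ) (hc : ∀ k, c (2 * k) = 0) (m : ℕ) :
    hankel c (2 * m) = 0 := by
  set A := Matrix.of fun i j : Fin (2 * m + 1) => c (i.1 + j.1) with hA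
  have h1 : (Matrix.of fun i j : Fin (2 * m + 1) =>
      (-1 : ℚ) ^ (i : ℕ) * (Matrix.of fun i j : Fin (2 * m + 1) =>
        (-1 : ℚ) ^ (j : ℕ) * A i j) i j) = -A := by
    ext i j
    simp only [Matrix.of_apply, Matrix.neg_apply, hA, ← mul_assoc, ← pow_add]
    rcases Nat.even_or_odd (i.1 + j.1) with h | h
    · obtain ⟨k, hk⟩ := h
      rw [hk, ← two_mul, hc]; simp
    · rw [h.neg_one_pow]; ring
  have h2 := congrArg Matrix.det h1
  rw [Matrix.det_mul_column, Matrix.det_mul_row, Matrix.det_neg, ← mul_assoc,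
    ← Finset.prod_mul_distrib] at h2
  simp only [← mul_pow, Fintype.card_fin] at h2
  rw [Odd.neg_one_pow ⟨m, rfl⟩] at h2
  norm_num at h2
  have : A.det = 0 := by linarith
  exact this

/-- Hankel determinants of even size split as a square when the even-indexed terms vanish. -/
lemma hankel_odd_eq_sq (c : ℕ → ℚ) (hc : ∀ k, c (2 * k) = 0) (m : ℕ) :
    hankel c (2 * m + 1) = (-1) ^ (m + 1) * hankel (fun k => c (2 * k + 1)) m ^ 2 := by
  let f : Fin (m + 1) ⊕ Fin (m + 1) → Fin (2 * m + 1 + 1) :=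
    Sum.elim (fun i => ⟨2 * i, by omega⟩) (fun i => ⟨2 * i + 1, by omega⟩)
  have hf : Function.Bijective f := by
    rw [Fintype.bijective_iff_injective_and_card]
    refine ⟨?_, by simp; omega⟩
    rintro (i | i) (j | j) h <;> simp [f, Fin.ext_iff] at h ⊢ <;> omega
  let e := Equiv.ofBijective f hf
  set B := Matrix.of fun i j : Fin (m + 1) => c (2 * (i.1 + j.1) + 1) with hB
  have hblock : (Matrix.of fun i j : Fin (2 * m + 1 + 1) => c (i.1 + j.1)).submatrix e e
      = Matrix.fromBlocks 0 B B 0 := by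
    ext i j
    rcases i with i | i <;> rcases j with j | j <;>
      simp only [Matrix.submatrix_apply, Matrix.of_apply, e, Equiv.ofBijective_apply, f,
        Sum.elim_inl, Sum.elim_inr, Matrix.fromBlocks_apply₁₁, Matrix.fromBlocks_apply₁₂,
        Matrix.fromBlocks_apply₂₁, Matrix.fromBlocks_apply₂₂, hB, Matrix.zero_apply]
    · rw [← mul_add, hc]
    · congr 1; ring
    · congr 1; ring
    · rw [show 2 * i.1 + 1 + (2 * j.1 + 1) = 2 * (i.1 + j.1 + 1) by ring, hc]
  have hmul : Matrix.fromBlocks 1 0 (-1) 1 * (Matrix.fromBlocks 1 1 0 1 *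
      Matrix.fromBlocks 0 B B 0) = Matrix.fromBlocks B B 0 (-B) := by
    simp [Matrix.fromBlocks_multiply]
  have hdet := congrArg Matrix.det hmul
  rw [Matrix.det_mul, Matrix.det_mul, Matrix.det_fromBlocks_zero₁₂, Matrix.det_fromBlocks_zero₂₁,
    Matrix.det_fromBlocks_zero₂₁, Matrix.det_neg] at hdet
  simp only [Matrix.det_one, one_mul, Fintype.card_fin] at hdet
  rw [hankel, ← Matrix.det_submatrix_equiv_self e, hblock, hdet, hankel]
  ring

end Checkerboard

section Hilbert

/-- The ratio `i!² / ((i - k)! (i + k)!)`, read as zero for `k > i`. -/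
def hilbertFactor (i k : ℕ) : ℚ := ∏ l ∈ Finset.range k, ((i : ℚ) - l) / (i + l + 1)

lemma hilbertFactor_eq_zero {i k : ℕ} (h : i < k) : hilbertFactor i k = 0 :=
  Finset.prod_eq_zero (Finset.mem_range.mpr h) (by simp)

lemma hilbertFactor_mul_factorial (i k : ℕ) :
    hilbertFactor i k * ((i + k).factorial : ℚ) = i.factorial * (i.descFactorial k : ℚ) := by
  induction k with
  | zero => simp [hilbertFactor]
  | succ k ih =>
    have hpos : (i : ℚ) + k + 1 ≠ 0 := by positivity
    have hd : ((i.descFactorial (k + 1) : ℕ) : ℚ) = ((i : ℚ) - k) * (i.descFactorial k : ℕ) := by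
      rw [Nat.descFactorial_succ]
      rcases le_or_gt k i with h | h
      · push_cast [Nat.cast_sub h]; ring
      · rw [Nat.descFactorial_of_lt h]; simp
    rw [hilbertFactor, Finset.prod_range_succ, ← hilbertFactor, hd, ← add_assoc,
      Nat.factorial_succ]
    push_cast
    field_simp
    linear_combination ((i : ℚ) - k) * ih

lemma hilbertFactor_self_succ (n : ℕ) :
    hilbertFactor (n + 1) (n + 1) = (n + 1) / (2 * (2 * n + 1)) * hilbertFactor n n := by
  have h0 := hilbertFactor_mul_factorial n n
  have h1 := hilbertFactor_mul_factorial (n + 1) (n + 1)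
  rw [Nat.descFactorial_self] at h0 h1
  rw [show n + 1 + (n + 1) = n + n + 1 + 1 by ring, Nat.factorial_succ, Nat.factorial_succ,
    Nat.factorial_succ] at h1
  push_cast at h1
  have hf : ((n + n).factorial : ℚ) ≠ 0 := by positivity
  have hn : (n : ℚ) + 1 ≠ 0 := by positivity
  have hn2 : 2 * (n : ℚ) + 1 ≠ 0 := by positivity
  refine mul_right_cancel₀ (mul_ne_zero hf (mul_ne_zero hn hn2)) ?_
  rw [show ((n : ℚ) + 1) / (2 * (2 * n + 1)) * hilbertFactor n n *
      ((n + n).factorial * ((n + 1) * (2 * n + 1)))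
    = (n + 1) ^ 2 / 2 * (hilbertFactor n n * (n + n).factorial) by field_simp]
  linear_combination h1 / 2 - (n + 1 : ℚ) ^ 2 / 2 * h0

lemma sum_hilbertFactor (i j K : ℕ) :
    ∑ k ∈ Finset.range K,
      hilbertFactor i k / (i + k + 1) * (2 * k + 1) * (hilbertFactor j k / (j + k + 1))
      = (1 - hilbertFactor i K * hilbertFactor j K) / (i + j + 1) := by
  induction K with
  | zero => simp [hilbertFactor]
  | succ K ih =>
    have h1 : (i : ℚ) + K + 1 ≠ 0 := by positivity
    have h2 : (j : ℚ) + K + 1 ≠ 0 := by positivity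
    have h3 : (i : ℚ) + j + 1 ≠ 0 := by positivity
    have hs : ∀ i : ℕ, hilbertFactor i (K + 1) = hilbertFactor i K * (((i : ℚ) - K) / (i + K + 1)) :=
      fun i => Finset.prod_range_succ _ _
    rw [Finset.sum_range_succ, ih, hs, hs]
    field_simp
    ring

/-- The factorisation `L D Lᵀ` of the Hilbert matrix gives its determinant, with rows and columns
rescaled by `α` and `β`. -/
lemma det_scaled_hilbert (w : ℚ) (α β : ℕ → ℚ) (n : ℕ) :
    (Matrix.of fun i j : Fin (n + 1) => w * α i * β j / ((i : ℚ) + j + 1)).det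
      = ∏ i ∈ Finset.range (n + 1), w * α i * β i * hilbertFactor i i ^ 2 / (2 * i + 1) := by
  set L : Matrix (Fin (n + 1)) (Fin (n + 1)) ℚ :=
    Matrix.of fun i k => hilbertFactor i k / ((i : ℚ) + k + 1) with hL
  have hfac : (Matrix.of fun i j : Fin (n + 1) => w * α i * β j / ((i : ℚ) + j + 1))
      = Matrix.diagonal (fun i : Fin (n + 1) => w * α i) *
        (L * Matrix.diagonal (fun i : Fin (n + 1) => 2 * (i : ℚ) + 1) * L.transpose) *
        Matrix.diagonal (fun i : Fin (n + 1) => β i) := by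
    ext i j
    rw [Matrix.mul_diagonal, Matrix.diagonal_mul, Matrix.mul_apply]
    simp only [Matrix.mul_diagonal, Matrix.transpose_apply, hL, Matrix.of_apply]
    rw [Fin.sum_univ_eq_sum_range (fun k => hilbertFactor i k / ((i : ℚ) + k + 1) * (2 * k + 1) *
      (hilbertFactor j k / (j + k + 1))) (n + 1), sum_hilbertFactor,
      hilbertFactor_eq_zero i.2]
    ring
  have hLdet : L.det = ∏ i : Fin (n + 1), hilbertFactor i i / ((i : ℚ) + i + 1) := by
    rw [Matrix.det_of_isLowerTriangular]
    · rfl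
    · intro i k hik
      have hik' : (i : ℕ) < k := by simpa using hik
      simp [hL, hilbertFactor_eq_zero hik']
  rw [hfac, Matrix.det_mul, Matrix.det_mul, Matrix.det_mul, Matrix.det_mul, Matrix.det_transpose,
    Matrix.det_diagonal, Matrix.det_diagonal, Matrix.det_diagonal, hLdet,
    ← Finset.prod_mul_distrib, ← Finset.prod_mul_distrib, ← Finset.prod_mul_distrib,
    ← Finset.prod_mul_distrib, ← Fin.prod_univ_eq_prod_range
      (fun i => w * α i * β i * hilbertFactor i i ^ 2 / (2 * i + 1)) (n + 1)]
  refine Finset.prod_congr rfl fun i _ => ?_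
  have h : 2 * (i : ℚ) + 1 ≠ 0 := by positivity
  rw [show (i : ℚ) + i + 1 = 2 * i + 1 by ring]
  field_simp

end Hilbert

section Wilson

open Polynomial

/-- The product `∏_{k < n} (X - (a + k)²)`, the building block of the Wilson polynomials. -/
noncomputable def wilsonBasis (a : ℚ) (n : ℕ) : ℚ[X] :=
  ∏ k ∈ Finset.range n, (X - C ((a + k) ^ 2))

lemma wilsonBasis_succ (a : ℚ) (n : ℕ) :
    wilsonBasis a (n + 1) = wilsonBasis a n * (X - C ((a + n) ^ 2)) :=
  Finset.prod_range_succ _ _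

lemma wilsonBasis_monic (a : ℚ) (n : ℕ) : (wilsonBasis a n).Monic :=
  monic_prod_of_monic _ _ fun _ _ => monic_X_sub_C _

lemma wilsonBasis_natDegree (a : ℚ) (n : ℕ) : (wilsonBasis a n).natDegree = n := by
  rw [wilsonBasis, natDegree_prod_of_monic _ _ fun _ _ => monic_X_sub_C _]
  simp only [natDegree_X_sub_C, Finset.sum_const, Finset.card_range, smul_eq_mul, mul_one]

/-- The functional `X ^ k ↦ B_{2k+1}(w)`. -/
noncomputable def oddBernoulliFunctional (w : ℚ) : ℚ[X] →ₗ[ℚ] ℚ :=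
  leval w ∘ₗ bernoulliMap ∘ₗ LinearMap.mulLeft ℚ X ∘ₗ (expand ℚ 2).toLinearMap

lemma oddBernoulliFunctional_apply (w : ℚ) (g : ℚ[X]) :
    oddBernoulliFunctional w g = (bernoulliMap (X * expand ℚ 2 g)).eval w := rfl

lemma oddBernoulliFunctional_X_pow (w : ℚ) (k : ℕ) :
    oddBernoulliFunctional w (X ^ k) = (Polynomial.bernoulli (2 * k + 1)).eval w := by
  rw [oddBernoulliFunctional_apply, map_pow, expand_X, ← pow_mul, ← pow_succ',
    bernoulliMap.map_X_pow]

lemma taylor_half_wilsonBasis (a : ℚ) (n : ℕ) :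
    taylor (1 / 2) (expand ℚ 2 (wilsonBasis (a - 1 / 2) (n + 1)))
      = expand ℚ 2 (wilsonBasis a n) * ((X + C (a + n)) * (X - C (a - 1))) := by
  induction n with
  | zero =>
    refine Polynomial.funext fun z => ?_
    simp [wilsonBasis]
    ring
  | succ n ih =>
    rw [wilsonBasis_succ, map_mul, taylor_mul, ih, wilsonBasis_succ, map_mul]
    refine Polynomial.funext fun z => ?_
    simp [taylor_eval]
    ring

lemma taylor_neg_half_wilsonBasis (a : ℚ) (n : ℕ) :
    taylor (-1 / 2) (expand ℚ 2 (wilsonBasis (a - 1 / 2) (n + 1)))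
      = expand ℚ 2 (wilsonBasis a n) * ((X - C (a + n)) * (X + C (a - 1))) := by
  induction n with
  | zero =>
    refine Polynomial.funext fun z => ?_
    simp [wilsonBasis]
    ring
  | succ n ih =>
    rw [wilsonBasis_succ, map_mul, taylor_mul, ih, wilsonBasis_succ, map_mul]
    refine Polynomial.funext fun z => ?_
    simp [taylor_eval]
    ring

lemma eval_expand_wilsonBasis_eq_zero {a z : ℚ} (h : z ^ 2 = a ^ 2) (n : ℕ) :
    (expand ℚ 2 (wilsonBasis a (n + 1))).eval z = 0 := by
  rw [expand_eval, wilsonBasis, eval_prod]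
  exact Finset.prod_eq_zero (Finset.mem_range.mpr n.succ_pos) (by simp [h])

lemma oddBernoulliFunctional_contiguous {a c w : ℚ} (hac : a + c = 1)
    (hw : (w - 1 / 2) ^ 2 = (a - 1 / 2) ^ 2) (i j : ℕ) :
    (i + j + 2 : ℚ) * oddBernoulliFunctional w (wilsonBasis a (i + 1) * wilsonBasis c j)
      = -((i + 1) * (i + j + 1) * (2 * a + i))
        * oddBernoulliFunctional w (wilsonBasis a i * wilsonBasis c j) := by
  obtain rfl : c = 1 - a := by linarith
  have hw' : (w - 1 / 2) ^ 2 = (1 - a - 1 / 2) ^ 2 := by rw [hw]; ring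
  have h := bernoulliMap.eval_map_central_diff
    (expand ℚ 2 (wilsonBasis (a - 1 / 2) (i + 1)) *
      expand ℚ 2 (wilsonBasis (1 - a - 1 / 2) (j + 1))) w
  rw [derivative_mul, eval_add, eval_mul, eval_mul, eval_expand_wilsonBasis_eq_zero hw,
    eval_expand_wilsonBasis_eq_zero hw', taylor_mul, taylor_mul, taylor_half_wilsonBasis,
    taylor_half_wilsonBasis, taylor_neg_half_wilsonBasis, taylor_neg_half_wilsonBasis] at h
  have hp : expand ℚ 2 (wilsonBasis a i) * ((X + C (a + i)) * (X - C (a - 1))) *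
        (expand ℚ 2 (wilsonBasis (1 - a) j) * ((X + C (1 - a + j)) * (X - C (1 - a - 1)))) -
      expand ℚ 2 (wilsonBasis a i) * ((X - C (a + i)) * (X + C (a - 1))) *
        (expand ℚ 2 (wilsonBasis (1 - a) j) * ((X - C (1 - a + j)) * (X + C (1 - a - 1))))
      = X * expand ℚ 2 ((2 * (i + j + 2) : ℚ) • (wilsonBasis a (i + 1) * wilsonBasis (1 - a) j) +
        (2 * ((i + 1) * (i + j + 1) * (2 * a + i)) : ℚ) •
          (wilsonBasis a i * wilsonBasis (1 - a) j)) := by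
    rw [wilsonBasis_succ]
    refine Polynomial.funext fun z => ?_
    simp
    ring
  rw [hp, ← oddBernoulliFunctional_apply, map_add, map_smul, map_smul, smul_eq_mul,
    smul_eq_mul] at h
  linear_combination h / 2

/-- The scaling factors in the closed form of the functional on products of Wilson bases. -/
def wilsonScale (a : ℚ) (n : ℕ) : ℚ := ∏ l ∈ Finset.range n, -((l + 1) * (2 * a + l))

lemma oddBernoulliFunctional_wilsonBasis_mul {a c : ℚ} (hac : a + c = 1) (i j : ℕ) :
    oddBernoulliFunctional c (wilsonBasis a i * wilsonBasis c j)
      = (c - 1 / 2) * wilsonScale a i * wilsonScale c j / (i + j + 1) := by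
  have hs : ∀ b n, wilsonScale b (n + 1) = wilsonScale b n * -((n + 1) * (2 * b + n)) :=
    fun b n => Finset.prod_range_succ _ _
  induction i with
  | zero =>
    induction j with
    | zero =>
      have h := oddBernoulliFunctional_X_pow c 0
      rw [pow_zero, mul_zero, zero_add, Polynomial.bernoulli_one] at h
      simp [wilsonBasis, wilsonScale, h]
    | succ j ih =>
      have h := oddBernoulliFunctional_contiguous (w := c) (add_comm a c ▸ hac) rfl j 0
      rw [mul_comm (wilsonBasis c _), mul_comm (wilsonBasis c _), ih] at h
      have h1 : (j : ℚ) + 1 ≠ 0 := by positivity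
      rw [hs, eq_div_iff (by positivity)]
      push_cast at h ⊢
      simp only [zero_add, add_zero] at h
      field_simp at h
      linear_combination h / 2
  | succ i ih =>
    have hw : (c - 1 / 2) ^ 2 = (a - 1 / 2) ^ 2 := by
      obtain rfl : c = 1 - a := by linarith
      ring
    have h := oddBernoulliFunctional_contiguous hac hw i j
    rw [ih] at h
    have h1 : (i : ℚ) + j + 1 ≠ 0 := by positivity
    rw [hs, eq_div_iff (by positivity)]
    push_cast at h ⊢
    field_simp at h
    linear_combination h / 2

end Wilson

/-- The Hankel determinant of the odd-indexed Bernoulli polynomials. -/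
lemma hankel_bernoulli_odd (y : ℚ) (n : ℕ) :
    hankel (fun k => (Polynomial.bernoulli (2 * k + 1)).eval ((1 + y) / 2)) n
      = ∏ i ∈ Finset.range (n + 1), y / 2 * ∏ ℓ ∈ Finset.Icc 1 i,
        -((ℓ : ℚ) ^ 4 * (y ^ 2 - (ℓ : ℚ) ^ 2)
          / (4 * (2 * (ℓ : ℚ) + 1) * (2 * (ℓ : ℚ) - 1))) := by
  have hac : (1 - y) / 2 + (1 + y) / 2 = 1 := by ring
  have h := hankel_eq_det_of_monic (oddBernoulliFunctional ((1 + y) / 2))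
    (wilsonBasis ((1 - y) / 2)) (wilsonBasis ((1 + y) / 2))
    (wilsonBasis_natDegree _) (wilsonBasis_monic _)
    (wilsonBasis_natDegree _) (wilsonBasis_monic _) n
  simp only [oddBernoulliFunctional_X_pow, oddBernoulliFunctional_wilsonBasis_mul hac] at h
  rw [h, det_scaled_hilbert]
  refine Finset.prod_congr rfl fun i hi => ?_
  clear hi h
  induction i with
  | zero => simp [wilsonScale, hilbertFactor]; ring
  | succ i ih =>
    have hs : ∀ b, wilsonScale b (i + 1) = wilsonScale b i * -((i + 1) * (2 * b + i)) :=
      fun b => Finset.prod_range_succ _ _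
    rw [Finset.prod_Icc_succ_top (by omega), ← mul_assoc, ← ih, hs, hs, hilbertFactor_self_succ]
    have h1 : 2 * (i : ℚ) + 1 ≠ 0 := by positivity
    have h2 : 2 * ((i : ℚ) + 1) + 1 ≠ 0 := by positivity
    have h3 : 2 * ((i : ℚ) + 1) - 1 ≠ 0 := by
      rw [show 2 * ((i : ℚ) + 1) - 1 = 2 * i + 1 by ring]; exact h1
    push_cast
    field_simp
    ring

lemma prod_range_prod_Icc {M : Type*} [CommMonoid M] (f : ℕ → M) (m : ℕ) :
    ∏ i ∈ Finset.range (m + 1), ∏ ℓ ∈ Finset.Icc 1 i, f ℓ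
      = ∏ ℓ ∈ Finset.Icc 1 m, f ℓ ^ (m + 1 - ℓ) := by
  induction m with
  | zero => simp
  | succ m ih =>
    have hstep : ∀ ℓ ∈ Finset.Icc 1 m, f ℓ ^ (m + 1 + 1 - ℓ) = f ℓ ^ (m + 1 - ℓ) * f ℓ := by
      intro ℓ hℓ
      rw [← pow_succ]
      congr 1
      have := (Finset.mem_Icc.mp hℓ).2
      omega
    rw [Finset.prod_range_succ, ih, Finset.prod_Icc_succ_top (by omega),
      Finset.prod_Icc_succ_top (by omega), Finset.prod_congr rfl hstep, Finset.prod_mul_distrib,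
      mul_assoc]
    simp

open Polynomial in
/-- Hankel determinants of differences of Bernoulli polynomials are translation invariant. -/
lemma hankel_bernoulli_diff_translate (u v h : ℚ) (n : ℕ) :
    hankel (fun k => (Polynomial.bernoulli k).eval (u + h)
        - (Polynomial.bernoulli k).eval (v + h)) n
      = hankel (fun k => (Polynomial.bernoulli k).eval u - (Polynomial.bernoulli k).eval v) n := by
  let M : ℚ[X] →ₗ[ℚ] ℚ := (leval u - leval v) ∘ₗ bernoulliMap
  have hM : ∀ p, M p = (bernoulliMap p).eval u - (bernoulliMap p).eval v := fun _ => rfl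
  have key := hankel_eq_det_of_monic M (fun i => (X + C h) ^ i) (fun i => (X + C h) ^ i)
    (fun i => natDegree_pow_X_add_C i h) (fun i => (monic_X_add_C h).pow i)
    (fun i => natDegree_pow_X_add_C i h) (fun i => (monic_X_add_C h).pow i) n
  simp only [← pow_add] at key
  simp only [← taylor_X_pow, hM, bernoulliMap.map_taylor, bernoulliMap.map_X_pow,
    taylor_eval] at key
  exact key.symm

theorem hankel_bernoulli_diff (q r s : ℕ) (hq : 1 ≤ q) (hrs : r < s) (x : ℚ) (m : ℕ) :
    hankel (fun k => (Polynomial.bernoulli k).eval ((x + r) / q)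
        - (Polynomial.bernoulli k).eval ((x + s) / q)) (2 * m) = 0 ∧
    hankel (fun k => (Polynomial.bernoulli k).eval ((x + r) / q)
        - (Polynomial.bernoulli k).eval ((x + s) / q)) (2 * m + 1)
      = (-1 : ℚ) ^ (m + 1) * (((s : ℚ) - r) / (q : ℚ) ^ (m + 1)) ^ (2 * m + 2) *
        ∏ ℓ ∈ Finset.Icc 1 m,
          ((ℓ : ℚ) ^ 4 * (((s : ℚ) - r) ^ 2 - ((q : ℚ) * ℓ) ^ 2)
              / (4 * (2 * (ℓ : ℚ) + 1) * (2 * (ℓ : ℚ) - 1))) ^ (2 * (m + 1 - ℓ)) := by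
  have hq' : (q : ℚ) ≠ 0 := by exact_mod_cast (by omega : q ≠ 0)
  set y : ℚ := ((s : ℚ) - r) / q with hy
  have htrans : ∀ n, hankel (fun k => (Polynomial.bernoulli k).eval ((x + r) / q)
        - (Polynomial.bernoulli k).eval ((x + s) / q)) n
      = hankel (fun k => ((-1) ^ k - 1) * (Polynomial.bernoulli k).eval ((1 + y) / 2)) n := by
    intro n
    have hr : (x + r) / q = 1 - (1 + y) / 2 + ((x + r) / q + (x + s) / q - 1) / 2 := by
      rw [hy]; field_simp; ring
    have hs : (x + s) / q = (1 + y) / 2 + ((x + r) / q + (x + s) / q - 1) / 2 := by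
      rw [hy]; field_simp; ring
    have h := hankel_bernoulli_diff_translate (1 - (1 + y) / 2) ((1 + y) / 2)
      (((x + r) / q + (x + s) / q - 1) / 2) n
    rw [← hr, ← hs] at h
    rw [h]
    congr 1
    funext k
    rw [Polynomial.bernoulli_eval_one_sub]
    ring
  have heven : ∀ k : ℕ, ((-1 : ℚ) ^ (2 * k) - 1) *
      (Polynomial.bernoulli (2 * k)).eval ((1 + y) / 2) = 0 := by
    intro k
    simp [pow_mul]
  refine ⟨by rw [htrans, hankel_even_eq_zero _ heven], ?_⟩
  have hodd : hankel (fun k => ((-1 : ℚ) ^ (2 * k + 1) - 1) *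
      (Polynomial.bernoulli (2 * k + 1)).eval ((1 + y) / 2)) m
      = (-2) ^ (m + 1) *
        hankel (fun k => (Polynomial.bernoulli (2 * k + 1)).eval ((1 + y) / 2)) m := by
    have h := Matrix.det_smul (Matrix.of fun i j : Fin (m + 1) =>
      (Polynomial.bernoulli (2 * (i.1 + j.1) + 1)).eval ((1 + y) / 2)) (-2 : ℚ)
    rw [Fintype.card_fin] at h
    rw [hankel, hankel, ← h]
    congr 1
    ext i j
    simp [pow_succ, pow_mul]
    norm_num
  rw [htrans, hankel_odd_eq_sq _ heven, hodd, hankel_bernoulli_odd, mul_assoc]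
  congr 1
  rw [Finset.prod_mul_distrib, Finset.prod_const, Finset.card_range, prod_range_prod_Icc,
    ← mul_assoc, ← mul_pow, mul_pow, ← Finset.prod_pow]
  have hfactor : ∀ ℓ ∈ Finset.Icc 1 m,
      ((-((ℓ : ℚ) ^ 4 * (y ^ 2 - (ℓ : ℚ) ^ 2)
          / (4 * (2 * (ℓ : ℚ) + 1) * (2 * (ℓ : ℚ) - 1)))) ^ (m + 1 - ℓ)) ^ 2
      = (((q : ℚ)⁻¹ ^ 4) ^ (m + 1 - ℓ)) *
        ((ℓ : ℚ) ^ 4 * (((s : ℚ) - r) ^ 2 - ((q : ℚ) * ℓ) ^ 2)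
              / (4 * (2 * (ℓ : ℚ) + 1) * (2 * (ℓ : ℚ) - 1))) ^ (2 * (m + 1 - ℓ)) := by
    intro ℓ _
    rw [← pow_mul, mul_comm (m + 1 - ℓ) 2, pow_mul, pow_mul, ← mul_pow]
    congr 1
    have hsq : y ^ 2 - (ℓ : ℚ) ^ 2
        = (q : ℚ)⁻¹ ^ 2 * (((s : ℚ) - r) ^ 2 - ((q : ℚ) * ℓ) ^ 2) := by
      rw [hy]; field_simp
    rw [hsq]
    ring
  rw [Finset.prod_congr rfl hfactor, Finset.prod_mul_distrib, ← prod_range_prod_Icc]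
  have hpow : ∏ i ∈ Finset.range (m + 1), ∏ _ℓ ∈ Finset.Icc 1 i, (q : ℚ)⁻¹ ^ 4
      = (q : ℚ)⁻¹ ^ (2 * m * (m + 1)) := by
    simp only [Finset.prod_const, Nat.card_Icc, Nat.add_sub_cancel, ← pow_mul]
    rw [Finset.prod_pow_eq_pow_sum, ← Finset.mul_sum]
    congr 1
    have := Finset.sum_range_id_mul_two (m + 1)
    rw [Nat.add_sub_cancel] at this
    linarith
  rw [hpow, ← mul_assoc]
  congr 1
  rw [hy, show -2 * (((s : ℚ) - r) / q / 2) = -(((s : ℚ) - r) * (q : ℚ)⁻¹) by ring,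
    div_eq_mul_inv, ← inv_pow, ← pow_mul, mul_comm (m + 1) 2, Even.neg_pow ⟨m + 1, two_mul _⟩]
  generalize (s : ℚ) - r = d
  ring
end

section
/- For all integers m ≥ 0, the Hankel determinant of the sequence (k·E_{k−1}(x))_{k≥0} (with first term 0) satisfies H_{2m}(k E_{k−1}(x)) = 0 and H_{2m+1}(k E_{k−1}(x)) = (−1)^{m+1} Π_{ℓ=1}^{m} (ℓ!)^8, as an identity of polynomials in x. -/
/-- The `n`-th Euler polynomial, evaluated at `x`, via
`E_n(x) = (2/(n+1)) (B_{n+1}(x) - 2^{n+1} B_{n+1}(x/2))`. -/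
noncomputable def eulerPoly (n : ℕ) (x : ℚ) : ℚ :=
  (2 / (n + 1)) *
    ((Polynomial.bernoulli (n + 1)).eval x - 2 ^ (n + 1) * (Polynomial.bernoulli (n + 1)).eval (x / 2))

open Polynomial

/-- The linear functional on polynomials whose `k`-th moment is `b k`. -/
noncomputable def momentFunctional {R : Type*} [CommRing R] (b : ℕ → R) : R[X] →ₗ[R] R :=
  (Polynomial.basisMonomials R).constr R b

theorem momentFunctional_X_pow {R : Type*} [CommRing R] (b : ℕ → R) (k : ℕ) :
    momentFunctional b (X ^ k) = b k := by
  have h := (Polynomial.basisMonomials R).constr_basis R b k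
  rw [Polynomial.coe_basisMonomials] at h
  rw [← Polynomial.monomial_one_right_eq_X_pow]
  exact h

theorem momentFunctional_C_mul {R : Type*} [CommRing R] (b : ℕ → R) (a : R) (p : R[X]) :
    momentFunctional b (C a * p) = a * momentFunctional b p := by
  rw [← smul_eq_C_mul, map_smul, smul_eq_mul]

/-- A Hankel determinant may be computed in any basis of monic polynomials. -/
theorem hankel_eq_det_monic {R : Type*} [CommRing R] (b : ℕ → R) (n : ℕ) (P : ℕ → R[X])
    (hdeg : ∀ i, (P i).natDegree = i) (hP : ∀ i, (P i).Monic) :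
    hankel b n =
      (Matrix.of fun i j : Fin (n + 1) => momentFunctional b (P i * P j)).det := by
  have hC := Matrix.det_matrixOfPolynomials (fun i : Fin (n + 1) => P i)
    (fun i => hdeg i) (fun i => hP i)
  set K : Matrix (Fin (n + 1)) (Fin (n + 1)) R := Matrix.of fun i j => (P j).coeff i with hK
  have hsum : ∀ i : Fin (n + 1), P i = ∑ k : Fin (n + 1), C ((P i).coeff k) * X ^ (k : ℕ) := by
    intro i
    rw [Fin.sum_univ_eq_sum_range (fun k => C ((P i).coeff k) * X ^ k)]
    exact (P i).as_sum_range_C_mul_X_pow' (by rw [hdeg]; exact i.2)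
  have hmul : (Matrix.of fun i j : Fin (n + 1) => momentFunctional b (P i * P j)) =
      K.transpose * (Matrix.of fun i j : Fin (n + 1) => b (i.1 + j.1)) * K := by
    ext i j
    rw [Matrix.of_apply, hsum i, hsum j, Finset.sum_mul_sum, Finset.sum_comm]
    simp only [map_sum, Matrix.mul_apply, Matrix.transpose_apply, Matrix.of_apply, hK,
      Finset.sum_mul]
    refine Finset.sum_congr rfl fun k _ => Finset.sum_congr rfl fun l _ => ?_
    rw [show C ((P i).coeff l) * X ^ (l : ℕ) * (C ((P j).coeff k) * X ^ (k : ℕ)) =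
      C ((P i).coeff l) * (C ((P j).coeff k) * X ^ ((l : ℕ) + k)) by ring,
      momentFunctional_C_mul, momentFunctional_C_mul, momentFunctional_X_pow]
    ring
  rw [hmul, Matrix.det_mul, Matrix.det_mul, Matrix.det_transpose, hC, hankel, one_mul, mul_one]

/-- A matrix of odd size supported on entries of odd index sum is singular. -/
theorem Matrix.det_eq_zero_of_checkerboard {n : ℕ} (hn : Odd n) (G : Matrix (Fin n) (Fin n) ℚ)
    (hG : ∀ i j : Fin n, Even (i.1 + j.1) → G i j = 0) : G.det = 0 := by
  have h1 : (Matrix.of fun i j : Fin n => (-1 : ℚ) ^ (j : ℕ) *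
      (Matrix.of fun i j : Fin n => (-1 : ℚ) ^ (i : ℕ) * G i j) i j) = -G := by
    ext i j
    simp only [Matrix.of_apply, Matrix.neg_apply]
    rcases Nat.even_or_odd (i.1 + j.1) with h | h
    · simp [hG i j h]
    · rw [← mul_assoc, ← pow_add, add_comm, h.neg_one_pow, neg_one_mul]
  have h2 := congrArg Matrix.det h1
  rw [Matrix.det_mul_row, Matrix.det_mul_column, Matrix.det_neg, Fintype.card_fin,
    hn.neg_one_pow, ← mul_assoc, ← Finset.prod_mul_distrib] at h2
  have h3 : ∀ i : Fin n, (-1 : ℚ) ^ (i : ℕ) * (-1) ^ (i : ℕ) = 1 := fun i => by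
    rw [← mul_pow]; simp
  rw [Finset.prod_congr rfl fun i _ => h3 i, Finset.prod_const_one] at h2
  linarith

/-- Splitting `Fin (2 * m + 2)` into its even and its odd elements. -/
noncomputable def evenOddEquiv (m : ℕ) : Fin (m + 1) ⊕ Fin (m + 1) ≃ Fin (2 * m + 1 + 1) :=
  Equiv.ofBijective
    (Sum.elim (fun i => ⟨2 * i.1, by omega⟩) (fun i => ⟨2 * i.1 + 1, by omega⟩)) <| by
    rw [Fintype.bijective_iff_injective_and_card]
    refine ⟨?_, by simp; omega⟩
    rintro (i | i) (j | j) h <;> simp [Fin.ext_iff] at h ⊢ <;> omega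

theorem Matrix.det_fromBlocks_antidiagonal {n : Type*} [Fintype n] [DecidableEq n]
    (A B : Matrix n n ℚ) :
    (Matrix.fromBlocks 0 A B 0).det = (-1) ^ Fintype.card n * (A.det * B.det) := by
  have h : Matrix.fromBlocks 0 A B 0 * Matrix.fromBlocks 0 1 1 1 =
      Matrix.fromBlocks A A 0 B := by
    simp [Matrix.fromBlocks_multiply]
  have h2 := congrArg Matrix.det h
  rw [Matrix.det_mul, Matrix.det_fromBlocks_one₂₂, Matrix.det_fromBlocks_zero₂₁, zero_sub,
    one_mul, Matrix.det_neg, Matrix.det_one, mul_one] at h2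
  rw [← h2, mul_comm, mul_assoc, ← mul_pow]
  simp

theorem Matrix.det_choose (m : ℕ) :
    (Matrix.of fun i j : Fin (m + 1) => (((i + j : ℕ).choose i : ℕ) : ℚ)).det = 1 := by
  set L : Matrix (Fin (m + 1)) (Fin (m + 1)) ℚ :=
    Matrix.of fun i k => (((i : ℕ).choose k : ℕ) : ℚ) with hL
  have hdet : L.det = 1 := by
    rw [Matrix.det_of_isLowerTriangular]
    · simp [hL]
    · intro i k hik
      have : (i : ℕ) < k := hik
      simp [hL, Nat.choose_eq_zero_of_lt this]
  have hmul : (Matrix.of fun i j : Fin (m + 1) => (((i + j : ℕ).choose i : ℕ) : ℚ)) =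
      L * L.transpose := by
    ext i j
    simp only [Matrix.mul_apply, Matrix.transpose_apply, Matrix.of_apply, hL]
    rw [Fin.sum_univ_eq_sum_range (fun k => (((i : ℕ).choose k : ℕ) : ℚ) * ((j : ℕ).choose k : ℕ)),
      Nat.add_choose_eq, Finset.Nat.sum_antidiagonal_eq_sum_range_succ
        (fun a b => (i : ℕ).choose a * (j : ℕ).choose b)]
    rw [← Finset.sum_subset (Finset.range_mono (show (i : ℕ) + 1 ≤ m + 1 by omega))]
    · rw [← Finset.sum_range_reflect]
      push_cast
      refine Finset.sum_congr rfl fun k hk => ?_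
      have hk : k ≤ i := by simpa [Nat.lt_succ_iff] using hk
      rw [Nat.choose_symm hk, Nat.sub_sub_self hk]
    · intro k _ hk
      have hk : (i : ℕ) < k := by simpa [Nat.lt_succ_iff] using hk
      simp [Nat.choose_eq_zero_of_lt hk]
  rw [hmul, Matrix.det_mul, Matrix.det_transpose, hdet, one_mul]

theorem Matrix.det_signed_factorial (m : ℕ) :
    (Matrix.of fun i j : Fin (m + 1) => (-1 : ℚ) ^ (i + j : ℕ) *
      ((i + j : ℕ).factorial * (i : ℕ).factorial * (j : ℕ).factorial)).det =
      ∏ ℓ ∈ Finset.Icc 1 m, (ℓ.factorial : ℚ) ^ 4 := by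
  have h : (Matrix.of fun i j : Fin (m + 1) => (-1 : ℚ) ^ (i + j : ℕ) *
      ((i + j : ℕ).factorial * (i : ℕ).factorial * (j : ℕ).factorial)) =
      Matrix.of fun i j : Fin (m + 1) => ((-1 : ℚ) ^ (j : ℕ) * ((j : ℕ).factorial : ℚ) ^ 2) *
        (Matrix.of fun i j : Fin (m + 1) => ((-1 : ℚ) ^ (i : ℕ) * ((i : ℕ).factorial : ℚ) ^ 2) *
          (Matrix.of fun i j : Fin (m + 1) => (((i + j : ℕ).choose i : ℕ) : ℚ)) i j) i j := by
    ext i j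
    simp only [Matrix.of_apply]
    have := Nat.add_choose_mul_factorial_mul_factorial (i : ℕ) j
    rw [← this, Nat.choose_symm_add]
    push_cast
    ring
  rw [h, Matrix.det_mul_row, Matrix.det_mul_column, Matrix.det_choose, mul_one,
    ← Finset.prod_mul_distrib,
    Fin.prod_univ_eq_prod_range (fun i => (-1 : ℚ) ^ i * (i.factorial : ℚ) ^ 2 *
      ((-1 : ℚ) ^ i * (i.factorial : ℚ) ^ 2)), Finset.prod_range_succ',
    Finset.range_eq_Ico, Finset.prod_Ico_add' (fun i => (-1 : ℚ) ^ i * (i.factorial : ℚ) ^ 2 *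
      ((-1 : ℚ) ^ i * (i.factorial : ℚ) ^ 2)) 0 m 1]
  simp only [pow_zero, Nat.factorial_zero, Nat.cast_one, one_pow, mul_one]
  refine Finset.prod_congr (by ext; simp) fun i _ => ?_
  have : (-1 : ℚ) ^ i * (-1) ^ i = 1 := by rw [← mul_pow]; simp
  linear_combination (i.factorial : ℚ) ^ 4 * this

/-- The sequence `k * E_{k-1}(x)`. -/
noncomputable def kEuler (x : ℚ) (k : ℕ) : ℚ := (k : ℚ) * eulerPoly (k - 1) x

theorem kEuler_eq (x : ℚ) (k : ℕ) :
    kEuler x k = 2 * ((Polynomial.bernoulli k).eval x -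
      2 ^ k * (Polynomial.bernoulli k).eval (x / 2)) := by
  rcases k with _ | k
  · simp [kEuler]
  · have : (k : ℚ) + 1 ≠ 0 := by positivity
    simp only [kEuler, eulerPoly, Nat.add_sub_cancel]
    push_cast
    field_simp

theorem kEuler_generating_function (x : ℚ) :
    (PowerSeries.mk fun n => kEuler x n / n.factorial) * (PowerSeries.exp ℚ + 1) =
      2 * PowerSeries.X * PowerSeries.rescale x (PowerSeries.exp ℚ) := by
  set e := PowerSeries.exp ℚ with he
  set F := fun y : ℚ => PowerSeries.mk fun n =>
    aeval y ((1 / n.factorial : ℚ) • Polynomial.bernoulli n) with hF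
  have hg : ∀ y, F y * (e - 1) = PowerSeries.X * PowerSeries.rescale y e := fun y =>
    Polynomial.bernoulli_generating_function y
  have hk : (PowerSeries.mk fun n => kEuler x n / n.factorial) =
      2 * (F x - PowerSeries.rescale 2 (F (x / 2))) := by
    ext n
    rw [show (2 : PowerSeries ℚ) = PowerSeries.C 2 from (map_ofNat PowerSeries.C 2).symm, PowerSeries.coeff_C_mul, map_sub,
      PowerSeries.coeff_rescale]
    simp only [hF, PowerSeries.coeff_mk, kEuler_eq, map_smul, smul_eq_mul, coe_aeval_eq_eval]
    ring
  have he2 : PowerSeries.rescale 2 e = e ^ 2 := by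
    have := PowerSeries.exp_pow_eq_rescale_exp (A := ℚ) 2
    rw [he, this]; norm_num
  have h2 := congrArg (PowerSeries.rescale (2 : ℚ)) (hg (x / 2))
  rw [map_mul, map_mul, map_sub, map_one, he2, PowerSeries.rescale_rescale,
    PowerSeries.rescale_X, show x / 2 * 2 = x by ring,
    show (PowerSeries.C (2 : ℚ)) = 2 from map_ofNat PowerSeries.C 2] at h2
  have hne : e - 1 ≠ 0 := by
    intro h
    have := congrArg (PowerSeries.coeff 1) h
    simp [he, PowerSeries.coeff_exp, PowerSeries.coeff_one] at this
  apply mul_right_cancel₀ hne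
  rw [hk]
  linear_combination 2 * (e + 1) * hg x - 2 * h2

theorem kEuler_functional_pow (x : ℚ) (n : ℕ) :
    momentFunctional (kEuler x) ((X + 1) ^ n + X ^ n) = 2 * (n * x ^ (n - 1)) := by
  have h := congrArg (PowerSeries.coeff n) (kEuler_generating_function x)
  rw [mul_add, mul_one, map_add, PowerSeries.coeff_mul,
    Finset.Nat.sum_antidiagonal_eq_sum_range_succ (fun a b =>
      PowerSeries.coeff a (PowerSeries.mk fun n => kEuler x n / n.factorial) *
      PowerSeries.coeff b (PowerSeries.exp ℚ)), mul_assoc,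
    show (2 : PowerSeries ℚ) = PowerSeries.C 2 from (map_ofNat PowerSeries.C 2).symm, PowerSeries.coeff_C_mul] at h
  simp only [PowerSeries.coeff_mk, PowerSeries.coeff_exp] at h
  have hf : (n.factorial : ℚ) ≠ 0 := by positivity
  have hr : (n.factorial : ℚ) * PowerSeries.coeff n
      (PowerSeries.X * PowerSeries.rescale x (PowerSeries.exp ℚ)) = n * x ^ (n - 1) := by
    rcases n with _ | n
    · simp
    · have : (n.factorial : ℚ) ≠ 0 := by positivity
      rw [PowerSeries.coeff_succ_X_mul, PowerSeries.coeff_rescale, PowerSeries.coeff_exp,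
        Nat.factorial_succ]
      simp
      field_simp
  rw [map_add, momentFunctional_X_pow, add_pow, map_sum, ← hr]
  have hs : ∀ k ∈ Finset.range (n + 1),
      momentFunctional (kEuler x) (X ^ k * 1 ^ (n - k) * (n.choose k : ℚ[X])) =
      n.factorial * (kEuler x k / k.factorial * algebraMap ℚ ℚ (1 / (n - k).factorial)) := by
    intro k hk
    have hk : k ≤ n := by simpa [Nat.lt_succ_iff] using hk
    rw [show X ^ k * 1 ^ (n - k) * (n.choose k : ℚ[X]) = C (n.choose k : ℚ) * X ^ k by
      simp [mul_comm], momentFunctional_C_mul, momentFunctional_X_pow, Nat.cast_choose ℚ hk]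
    simp
    ring
  rw [Finset.sum_congr rfl hs, ← Finset.mul_sum]
  have h3 : (n.factorial : ℚ) * (kEuler x n / n.factorial) = kEuler x n := by field_simp
  linear_combination (n.factorial : ℚ) * h - h3

theorem kEuler_functional_comp (x : ℚ) (f : ℚ[X]) :
    momentFunctional (kEuler x) (f.comp (X + 1) + f) = 2 * (derivative f).eval x := by
  induction f using Polynomial.induction_on' with
  | add p q hp hq =>
    rw [add_comp, show p.comp (X + 1) + q.comp (X + 1) + (p + q) =
      (p.comp (X + 1) + p) + (q.comp (X + 1) + q) by ring, map_add, hp, hq, derivative_add,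
      eval_add]
    ring
  | monomial n a =>
    rw [← C_mul_X_pow_eq_monomial, C_mul_comp, pow_comp, X_comp, ← mul_add,
      momentFunctional_C_mul, kEuler_functional_pow, derivative_C_mul,
      derivative_X_pow]
    simp only [eval_mul, eval_C, eval_pow, eval_X]
    ring

/-- The monic polynomial `∏_{j<n} (z² - (j + 1/2)²)` in `z = X - (x - 1/2)`. -/
noncomputable def eulerBasis (x : ℚ) : ℕ → ℚ[X]
  | 0 => 1
  | n + 1 => eulerBasis x n * ((X - C (x + n)) * (X - C (x - 1 - n)))

theorem eulerBasis_monic (x : ℚ) (n : ℕ) : (eulerBasis x n).Monic := by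
  induction n with
  | zero => exact monic_one
  | succ n ih => exact ih.mul ((monic_X_sub_C _).mul (monic_X_sub_C _))

theorem eulerBasis_natDegree (x : ℚ) (n : ℕ) : (eulerBasis x n).natDegree = 2 * n := by
  induction n with
  | zero => simp [eulerBasis]
  | succ n ih =>
    rw [eulerBasis, (eulerBasis_monic x n).natDegree_mul
      ((monic_X_sub_C _).mul (monic_X_sub_C _)),
      (monic_X_sub_C _).natDegree_mul (monic_X_sub_C _), ih, natDegree_X_sub_C,
      natDegree_X_sub_C]
    ring

theorem eulerBasis_comp (x : ℚ) (n : ℕ) :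
    (eulerBasis x n * (X - C (x + n))).comp (X + 1) =
      eulerBasis x n * (X - C (x - 1 - n)) := by
  induction n with
  | zero => simp [eulerBasis]; ring
  | succ n ih =>
    simp only [eulerBasis, mul_comp, sub_comp, X_comp, C_comp] at ih ⊢
    push_cast
    simp only [map_add, map_sub, map_one, map_natCast] at ih ⊢
    linear_combination (X - C x - n) * (X - C x + n + 2) * ih

theorem eulerBasis_mul_eval (x : ℚ) (n : ℕ) :
    (eulerBasis x n * (X - C (x + n))).eval x = 0 ∧
      (derivative (eulerBasis x n * (X - C (x + n)))).eval x =
        (-1) ^ n * (n.factorial : ℚ) ^ 2 := by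
  induction n with
  | zero => simp [eulerBasis]
  | succ n ih =>
    have h : eulerBasis x (n + 1) * (X - C (x + (n + 1 : ℕ))) =
        eulerBasis x n * (X - C (x + n)) *
          ((X - C (x - 1 - n)) * (X - C (x + (n + 1 : ℕ)))) := by
      rw [eulerBasis]; ring
    rw [h]
    generalize eulerBasis x n * (X - C (x + n)) = f at ih
    rw [derivative_mul, eval_add, eval_mul, ih.1, Nat.factorial_succ]
    refine ⟨by ring, ?_⟩
    simp only [eval_mul, eval_sub, eval_X, eval_C, ih.1, ih.2]
    push_cast
    ring

theorem kEuler_functional_center_mul_eulerBasis (x : ℚ) (n : ℕ) :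
    momentFunctional (kEuler x) ((X - C (x - 1 / 2)) * eulerBasis x n) =
      (-1) ^ n * (n.factorial : ℚ) ^ 2 := by
  have h := kEuler_functional_comp x (eulerBasis x n * (X - C (x + n)))
  have hC : C (x - 1 - n) + C (x + n) = C 2 * C (x - 1 / 2) := by
    rw [← C_mul, ← C_add]; congr 1; ring
  have h2 : (C 2 : ℚ[X]) = 2 := map_ofNat C 2
  rw [eulerBasis_comp, (eulerBasis_mul_eval x n).2,
    show eulerBasis x n * (X - C (x - 1 - n)) + eulerBasis x n * (X - C (x + n)) =
      C 2 * ((X - C (x - 1 / 2)) * eulerBasis x n) by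
      linear_combination (-eulerBasis x n) * hC - eulerBasis x n * X * h2,
    momentFunctional_C_mul] at h
  linarith

theorem kEuler_functional_eulerBasis (x : ℚ) (n : ℕ) :
    momentFunctional (kEuler x) (eulerBasis x n) = 0 := by
  induction n with
  | zero =>
    rw [eulerBasis, ← pow_zero X, momentFunctional_X_pow]
    simp [kEuler]
  | succ n ih =>
    have hd : (derivative ((X - C x) * (eulerBasis x n * (X - C (x + n))))).eval x = 0 := by
      rw [derivative_mul, derivative_X_sub_C, one_mul, eval_add, (eulerBasis_mul_eval x n).1]
      simp
    have h := kEuler_functional_comp x ((X - C x) * (eulerBasis x n * (X - C (x + n))))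
    rw [hd, mul_comp, eulerBasis_comp,
      show (X - C x : ℚ[X]).comp (X + 1) * (eulerBasis x n * (X - C (x - 1 - n))) +
        (X - C x) * (eulerBasis x n * (X - C (x + n))) =
        C 2 * eulerBasis x (n + 1) + C ((n + 1) * (2 * n + 1) : ℚ) * eulerBasis x n by
        simp only [eulerBasis, sub_comp, X_comp, C_comp, map_add, map_sub, map_mul, map_one,
          map_natCast, map_ofNat]
        ring,
      map_add, momentFunctional_C_mul, momentFunctional_C_mul, ih] at h
    simpa using h

theorem eulerBasis_mul_succ (x : ℚ) (i j : ℕ) :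
    eulerBasis x i * eulerBasis x (j + 1) = eulerBasis x (i + 1) * eulerBasis x j +
      C (i * (i + 1) - j * (j + 1) : ℚ) * (eulerBasis x i * eulerBasis x j) := by
  simp only [eulerBasis, map_add, map_sub, map_mul, map_one, map_natCast]
  ring

theorem kEuler_functional_mul (x : ℚ) (i j : ℕ) :
    momentFunctional (kEuler x) (eulerBasis x i * eulerBasis x j) = 0 := by
  induction j generalizing i with
  | zero => rw [eulerBasis, mul_one, kEuler_functional_eulerBasis]
  | succ j ih =>
    rw [eulerBasis_mul_succ, map_add, momentFunctional_C_mul, ih, ih, mul_zero, add_zero]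

theorem kEuler_functional_center_mul (x : ℚ) (i j : ℕ) :
    momentFunctional (kEuler x) ((X - C (x - 1 / 2)) * (eulerBasis x i * eulerBasis x j)) =
      (-1) ^ (i + j) * ((i + j).factorial * i.factorial * j.factorial) := by
  induction j generalizing i with
  | zero =>
    rw [eulerBasis, mul_one, kEuler_functional_center_mul_eulerBasis]
    simp
    ring
  | succ j ih =>
    rw [eulerBasis_mul_succ, mul_add, mul_left_comm _ (C _), map_add, momentFunctional_C_mul,
      ih, ih, show i + 1 + j = i + j + 1 by ring, ← add_assoc]
    simp only [Nat.factorial_succ]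
    push_cast
    ring

theorem kEuler_functional_center_sq_mul (x : ℚ) (i j : ℕ) :
    momentFunctional (kEuler x)
      ((X - C (x - 1 / 2)) ^ 2 * (eulerBasis x i * eulerBasis x j)) = 0 := by
  have hC : (C (x - 1 / 2)) ^ 2 = C (x + i) * C (x - 1 - i) + C (i * (i + 1) + 1 / 4 : ℚ) := by
    rw [← C_mul, ← C_add, ← C_pow]; congr 1; ring
  have hC2 : C (x - 1 - i) + C (x + i) = 2 * C (x - 1 / 2) := by
    rw [show (2 : ℚ[X]) = C 2 from (map_ofNat C 2).symm, ← C_mul, ← C_add]; congr 1; ring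
  have h : (X - C (x - 1 / 2)) ^ 2 * (eulerBasis x i * eulerBasis x j) =
      eulerBasis x (i + 1) * eulerBasis x j +
        C (i * (i + 1) + 1 / 4 : ℚ) * (eulerBasis x i * eulerBasis x j) := by
    rw [eulerBasis]
    linear_combination eulerBasis x i * eulerBasis x j * (hC + X * hC2)
  rw [h, map_add, momentFunctional_C_mul, kEuler_functional_mul, kEuler_functional_mul,
    mul_zero, add_zero]

/-- A monic basis, even and odd around `x - 1/2`, with one polynomial in each degree. -/
noncomputable def eulerFullBasis (x : ℚ) (k : ℕ) : ℚ[X] :=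
  (X - C (x - 1 / 2)) ^ (k % 2) * eulerBasis x (k / 2)

theorem eulerFullBasis_monic (x : ℚ) (k : ℕ) : (eulerFullBasis x k).Monic :=
  ((monic_X_sub_C _).pow _).mul (eulerBasis_monic x _)

theorem eulerFullBasis_natDegree (x : ℚ) (k : ℕ) : (eulerFullBasis x k).natDegree = k := by
  rw [eulerFullBasis, ((monic_X_sub_C _).pow _).natDegree_mul (eulerBasis_monic x _),
    eulerBasis_natDegree, natDegree_pow, natDegree_X_sub_C, mul_one, Nat.mod_add_div]

theorem eulerFullBasis_mul (x : ℚ) (i j : ℕ) :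
    eulerFullBasis x i * eulerFullBasis x j = (X - C (x - 1 / 2)) ^ (i % 2 + j % 2) *
      (eulerBasis x (i / 2) * eulerBasis x (j / 2)) := by
  rw [eulerFullBasis, eulerFullBasis]; ring

theorem kEuler_functional_eulerFullBasis_of_even (x : ℚ) {i j : ℕ} (h : Even (i + j)) :
    momentFunctional (kEuler x) (eulerFullBasis x i * eulerFullBasis x j) = 0 := by
  rw [eulerFullBasis_mul]
  have : i % 2 + j % 2 = 0 ∨ i % 2 + j % 2 = 2 := by
    rw [Nat.even_iff] at h; omega
  rcases this with h | h <;> rw [h]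
  · rw [pow_zero, one_mul, kEuler_functional_mul]
  · exact kEuler_functional_center_sq_mul x _ _

theorem kEuler_functional_eulerFullBasis_of_odd (x : ℚ) {i j : ℕ} (h : Odd (i + j)) :
    momentFunctional (kEuler x) (eulerFullBasis x i * eulerFullBasis x j) =
      (-1) ^ (i / 2 + j / 2) *
        ((i / 2 + j / 2).factorial * (i / 2).factorial * (j / 2).factorial) := by
  have : i % 2 + j % 2 = 1 := by
    rw [Nat.odd_iff] at h; omega
  rw [eulerFullBasis_mul, this, pow_one, kEuler_functional_center_mul]

theorem hankel_k_euler_poly (x : ℚ) (m : ℕ) :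
    hankel (fun k => (k : ℚ) * eulerPoly (k - 1) x) (2 * m) = 0 ∧
    hankel (fun k => (k : ℚ) * eulerPoly (k - 1) x) (2 * m + 1)
      = (-1 : ℚ) ^ (m + 1) * ∏ ℓ ∈ Finset.Icc 1 m, ((Nat.factorial ℓ : ℚ)) ^ 8 := by
  change hankel (kEuler x) (2 * m) = 0 ∧ hankel (kEuler x) (2 * m + 1) = _
  constructor
  · rw [hankel_eq_det_monic _ _ _ (eulerFullBasis_natDegree x) (eulerFullBasis_monic x)]
    exact Matrix.det_eq_zero_of_checkerboard ⟨m, rfl⟩ _ fun i j h =>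
      kEuler_functional_eulerFullBasis_of_even x h
  · rw [hankel_eq_det_monic _ _ _ (eulerFullBasis_natDegree x) (eulerFullBasis_monic x),
      ← Matrix.det_submatrix_equiv_self (evenOddEquiv m)]
    set A : Matrix (Fin (m + 1)) (Fin (m + 1)) ℚ := Matrix.of fun i j =>
      (-1 : ℚ) ^ (i + j : ℕ) *
        ((i + j : ℕ).factorial * (i : ℕ).factorial * (j : ℕ).factorial) with hA
    have hblocks : (Matrix.of fun i j : Fin (2 * m + 1 + 1) =>
        momentFunctional (kEuler x) (eulerFullBasis x i * eulerFullBasis x j)).submatrix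
          (evenOddEquiv m) (evenOddEquiv m) = Matrix.fromBlocks 0 A A 0 := by
      have hl : ∀ i : Fin (m + 1), (evenOddEquiv m (Sum.inl i) : ℕ) = 2 * i := fun _ => rfl
      have hr : ∀ i : Fin (m + 1), (evenOddEquiv m (Sum.inr i) : ℕ) = 2 * i + 1 := fun _ => rfl
      have hd : ∀ i : ℕ, (2 * i + 1) / 2 = i := by omega
      have hd' : ∀ i : ℕ, 2 * i / 2 = i := by omega
      ext (i | i) (j | j)
      · exact kEuler_functional_eulerFullBasis_of_even x
          (by rw [hl, hl, Nat.even_iff]; omega)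
      · refine (kEuler_functional_eulerFullBasis_of_odd x
          (by rw [hl, hr, Nat.odd_iff]; omega)).trans ?_
        rw [hl, hr, hd, hd', Matrix.fromBlocks_apply₁₂, hA, Matrix.of_apply]
      · refine (kEuler_functional_eulerFullBasis_of_odd x
          (by rw [hl, hr, Nat.odd_iff]; omega)).trans ?_
        rw [hl, hr, hd, hd', Matrix.fromBlocks_apply₂₁, hA, Matrix.of_apply]
      · exact kEuler_functional_eulerFullBasis_of_even x
          (by rw [hr, hr, Nat.even_iff]; omega)
    rw [hblocks, Matrix.det_fromBlocks_antidiagonal, hA, Matrix.det_signed_factorial,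
      ← Finset.prod_mul_distrib, Fintype.card_fin]
    congr 1
    exact Finset.prod_congr rfl fun _ _ => by ring
end
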